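/- For every real s ≠ 0, the square-summability estimate (∑_{m≠n} |Q(s)_{mn} − A(s)_{mn}|²)^{1/2} ≤ (1/2)·|s|·(1+|s|)^{(3+|s|)/2} holds, where the sum runs over all pairs of distinct m, n ∈ ℕ∪{0}; in particular the matrix Q(s) − A(s) defines a Hilbert–Schmidt operator on ℓ²(ℕ∪{0}) with Hilbert–Schmidt norm at most (1/2)·|s|·(1+|s|)^{(3+|s|)/2}. -/

import Mathlib

/-- `γ_n(s) = (Γ(n+|s|+1)/n!)^{1/2}`. -/
noncomputable def gammaCoef (s : ℝ) (n : ℕ) : ℝ :=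
  Real.sqrt (Real.Gamma ((n : ℝ) + |s| + 1) / (Nat.factorial n : ℝ))

/-- The matrix `Q(s)`. -/
noncomputable def Qmat (s : ℝ) (m n : ℕ) : ℂ :=
  if m = n then 0
  else (Complex.I * (Real.sign s : ℝ) / (2 * (((n : ℝ) : ℂ) - ((m : ℝ) : ℂ)))) *
    ((min (gammaCoef s m / gammaCoef s n) (gammaCoef s n / gammaCoef s m) : ℝ) : ℂ)

/-- The comparison matrix `A(s)`. -/
noncomputable def Amat (s : ℝ) (m n : ℕ) : ℂ :=
  if m = n then 0
  else (Complex.I * (Real.sign s : ℝ) / (2 * (((n : ℝ) : ℂ) - ((m : ℝ) : ℂ)))) *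
    ((min ((((m : ℝ) + 1) / ((n : ℝ) + 1)) ^ (|s| / 2))
        ((((n : ℝ) + 1) / ((m : ℝ) + 1)) ^ (|s| / 2)) : ℝ) : ℂ)

lemma min_div_eq_exp_neg_abs {x y : ℝ} (hx : 0 < x) (hy : 0 < y) :
    min (x / y) (y / x) = Real.exp (-|Real.log x - Real.log y|) := by
  have h1 : x / y = Real.exp (Real.log x - Real.log y) := by
    rw [Real.exp_sub, Real.exp_log hx, Real.exp_log hy]
  have h2 : y / x = Real.exp (-(Real.log x - Real.log y)) := by
    rw [neg_sub, Real.exp_sub, Real.exp_log hx, Real.exp_log hy]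
  rw [h1, h2, ← Real.exp_monotone.map_min]
  congr 1
  rw [abs_eq_max_neg, ← min_neg_neg, neg_neg, min_comm]

lemma abs_exp_neg_abs_sub_exp_neg_abs_le (u v : ℝ) :
    |Real.exp (-|u|) - Real.exp (-|v|)| ≤ |u - v| := by
  have key : ∀ a b : ℝ, 0 ≤ a → Real.exp (-a) - Real.exp (-b) ≤ |a - b| := by
    intro a b ha
    have h1 : Real.exp (-b) = Real.exp (-a) * Real.exp (a - b) := by
      rw [← Real.exp_add]; ring_nf
    have h2 : Real.exp (-a) ≤ 1 := Real.exp_le_one_iff.mpr (by linarith)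
    have h3 := Real.add_one_le_exp (a - b)
    have h4 := Real.exp_pos (-a)
    have h5 := neg_abs_le (a - b)
    have h6 := abs_nonneg (a - b)
    rw [h1]
    nlinarith [mul_le_mul_of_nonneg_left h3 h4.le, mul_le_mul_of_nonneg_left h5 h4.le]
  refine le_trans ?_ (abs_abs_sub_abs_le_abs_sub u v)
  rw [abs_le]
  have h1 := key |u| |v| (abs_nonneg _)
  have h2 := key |v| |u| (abs_nonneg _)
  rw [abs_sub_comm |v| |u|] at h2
  constructor <;> linarith

lemma gammaCoef_pos (s : ℝ) (n : ℕ) : 0 < gammaCoef s n :=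
  Real.sqrt_pos.mpr (div_pos (Real.Gamma_pos_of_pos (by positivity)) (by positivity))

lemma log_gammaCoef_succ_sub (s : ℝ) (n : ℕ) :
    Real.log (gammaCoef s (n + 1)) - Real.log (gammaCoef s n) =
      Real.log (1 + |s| / ((n : ℝ) + 1)) / 2 := by
  have hΓ : 0 < Real.Gamma ((n : ℝ) + |s| + 1) := Real.Gamma_pos_of_pos (by positivity)
  have hn : (0 : ℝ) < (n : ℝ) + |s| + 1 := by positivity
  have h : Real.Gamma (((n + 1 : ℕ) : ℝ) + |s| + 1) / (Nat.factorial (n + 1) : ℝ) =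
      (1 + |s| / ((n : ℝ) + 1)) * (Real.Gamma ((n : ℝ) + |s| + 1) / (Nat.factorial n : ℝ)) := by
    rw [show ((n + 1 : ℕ) : ℝ) + |s| + 1 = ((n : ℝ) + |s| + 1) + 1 by push_cast; ring,
      Real.Gamma_add_one hn.ne', Nat.factorial_succ]
    push_cast
    field_simp
    ring
  unfold gammaCoef
  rw [h, Real.log_sqrt (by positivity), Real.log_sqrt (by positivity),
    Real.log_mul (by positivity) (by positivity)]
  ring

/-- The logarithm of `γ_n(s) / (n + 1)^{|s|/2}`. -/
noncomputable def logGammaCoefRatio (s : ℝ) (n : ℕ) : ℝ :=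
  Real.log (gammaCoef s n) - |s| / 2 * Real.log ((n : ℝ) + 1)

lemma abs_logGammaCoefRatio_succ_sub_le (s : ℝ) (n : ℕ) :
    |logGammaCoefRatio s (n + 1) - logGammaCoefRatio s n| ≤
      |s| * (1 + |s|) / 2 * (1 / ((n : ℝ) + 1) - 1 / ((n : ℝ) + 1 + 1)) := by
  have hσ := abs_nonneg s
  set σ := |s| with hσdef
  have hk : (0 : ℝ) < (n : ℝ) + 1 := by positivity
  have h0 : logGammaCoefRatio s (n + 1) - logGammaCoefRatio s n =
      (Real.log (1 + σ / ((n : ℝ) + 1)) - σ * Real.log (1 + 1 / ((n : ℝ) + 1))) / 2 := by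
    have h := log_gammaCoef_succ_sub s n
    have h1 : Real.log (1 + 1 / ((n : ℝ) + 1)) =
        Real.log (((n + 1 : ℕ) : ℝ) + 1) - Real.log ((n : ℝ) + 1) := by
      rw [← Real.log_div (by positivity) (by positivity)]
      congr 1
      push_cast
      field_simp
    rw [← hσdef] at h
    rw [h1]
    unfold logGammaCoefRatio
    linarith
  rw [h0]
  generalize (n : ℝ) + 1 = k at hk ⊢
  have lower : ∀ t : ℝ, 0 ≤ t → t / (k + t) ≤ Real.log (1 + t / k) := by
    intro t ht
    have h := Real.one_sub_inv_le_log_of_pos (show 0 < 1 + t / k by positivity)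
    have e : 1 - (1 + t / k)⁻¹ = t / (k + t) := by
      field_simp
      ring
    rwa [e] at h
  have upper : ∀ t : ℝ, 0 ≤ t → Real.log (1 + t / k) ≤ t / k := by
    intro t ht
    have h := Real.log_le_sub_one_of_pos (show 0 < 1 + t / k by positivity)
    linarith
  have l1 := mul_le_mul_of_nonneg_left (lower 1 zero_le_one) hσ
  have u1 := mul_le_mul_of_nonneg_left (upper 1 zero_le_one) hσ
  have lσ := lower σ hσ
  have uσ := upper σ hσ
  have e1 : σ / k - σ * (1 / (k + 1)) ≤ σ * (1 + σ) * (1 / k - 1 / (k + 1)) := by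
    have : 0 ≤ 1 / k - 1 / (k + 1) := by
      rw [sub_nonneg]; gcongr; linarith
    have e : σ / k - σ * (1 / (k + 1)) = σ * (1 / k - 1 / (k + 1)) := by ring
    rw [e]
    nlinarith [mul_nonneg (mul_nonneg hσ hσ) this]
  have e2 : σ * (1 / k) - σ / (k + σ) ≤ σ * (1 + σ) * (1 / k - 1 / (k + 1)) := by
    have ea : σ * (1 / k) - σ / (k + σ) = σ * (σ / (k * (k + σ))) := by
      field_simp
      ring
    have eb : σ * (1 + σ) * (1 / k - 1 / (k + 1)) = σ * ((1 + σ) / (k * (k + 1))) := by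
      field_simp
      ring
    rw [ea, eb]
    refine mul_le_mul_of_nonneg_left ?_ hσ
    rw [div_le_div_iff₀ (by positivity) (by positivity)]
    nlinarith [mul_nonneg hk.le (show 0 ≤ k + σ + σ ^ 2 by positivity)]
  rw [abs_le]
  constructor <;> linarith

lemma abs_logGammaCoefRatio_sub_le (s : ℝ) (m n : ℕ) :
    |logGammaCoefRatio s m - logGammaCoefRatio s n| ≤
      |s| * (1 + |s|) / 2 * |1 / ((m : ℝ) + 1) - 1 / ((n : ℝ) + 1)| := by
  wlog hmn : m ≤ n generalizing m n
  · rw [abs_sub_comm, abs_sub_comm (1 / ((m : ℝ) + 1))]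
    exact this n m (by omega)
  refine le_trans ?_ (mul_le_mul_of_nonneg_left (le_abs_self _) (by positivity))
  induction n, hmn using Nat.le_induction with
  | base => simp
  | succ n _ ih =>
    have h := abs_logGammaCoefRatio_succ_sub_le s n
    have h3 := abs_sub_le (logGammaCoefRatio s m) (logGammaCoefRatio s n)
      (logGammaCoefRatio s (n + 1))
    rw [abs_sub_comm (logGammaCoefRatio s n)] at h3
    push_cast
    linarith

lemma norm_Qmat_sub_Amat_sq_le (s : ℝ) (m n : ℕ) :
    ‖Qmat s m n - Amat s m n‖ ^ 2 ≤
      (|s| * (1 + |s|) / 4) ^ 2 * (1 / ((m : ℝ) + 1) ^ 2 * (1 / ((n : ℝ) + 1) ^ 2)) := by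
  by_cases hmn : m = n
  · simp only [Qmat, Amat, if_pos hmn, sub_self, norm_zero, zero_pow two_ne_zero]
    positivity
  have hm : (0 : ℝ) < (m : ℝ) + 1 := by positivity
  have hn : (0 : ℝ) < (n : ℝ) + 1 := by positivity
  have hne : (n : ℝ) - m ≠ 0 := sub_ne_zero.mpr (by exact_mod_cast Ne.symm hmn)
  have hpre : ‖Complex.I * (Real.sign s : ℝ) / (2 * (((n : ℝ) : ℂ) - ((m : ℝ) : ℂ)))‖ ≤
      1 / (2 * |(n : ℝ) - m|) := by
    rw [← Complex.ofReal_sub, norm_div, norm_mul, norm_mul, Complex.norm_I, Complex.norm_real,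
      Complex.norm_real, Real.norm_eq_abs, Real.norm_eq_abs, one_mul, Complex.norm_ofNat]
    gcongr
    rcases Real.sign_apply_eq s with h | h | h <;> simp [h]
  have hA : min ((((m : ℝ) + 1) / ((n : ℝ) + 1)) ^ (|s| / 2))
      ((((n : ℝ) + 1) / ((m : ℝ) + 1)) ^ (|s| / 2)) =
      Real.exp (-|(|s| / 2 * Real.log ((m : ℝ) + 1)) - |s| / 2 * Real.log ((n : ℝ) + 1)|) := by
    rw [Real.div_rpow hm.le hn.le, Real.div_rpow hn.le hm.le,
      min_div_eq_exp_neg_abs (by positivity) (by positivity), Real.log_rpow hm, Real.log_rpow hn]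
  have hD := (abs_exp_neg_abs_sub_exp_neg_abs_le
    (Real.log (gammaCoef s m) - Real.log (gammaCoef s n))
    ((|s| / 2 * Real.log ((m : ℝ) + 1)) - |s| / 2 * Real.log ((n : ℝ) + 1)))
  rw [← min_div_eq_exp_neg_abs (gammaCoef_pos s m) (gammaCoef_pos s n), ← hA,
    sub_sub_sub_comm] at hD
  have hD' := hD.trans (abs_logGammaCoefRatio_sub_le s m n)
  have hfrac : |1 / ((m : ℝ) + 1) - 1 / ((n : ℝ) + 1)| =
      |(n : ℝ) - m| * (1 / (((m : ℝ) + 1) * ((n : ℝ) + 1))) := by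
    rw [← abs_of_pos (show 0 < 1 / (((m : ℝ) + 1) * ((n : ℝ) + 1)) by positivity), ← abs_mul]
    congr 1
    field_simp
    ring
  rw [hfrac] at hD'
  have hnorm : ‖Qmat s m n - Amat s m n‖ ≤
      |s| * (1 + |s|) / 4 * (1 / (((m : ℝ) + 1) * ((n : ℝ) + 1))) := by
    rw [Qmat, Amat, if_neg hmn, if_neg hmn, ← mul_sub, norm_mul, ← Complex.ofReal_sub (min _ _),
      Complex.norm_real, Real.norm_eq_abs]
    refine (mul_le_mul hpre hD' (abs_nonneg _) (by positivity)).trans_eq ?_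
    have := abs_pos.mpr hne
    field_simp
    ring
  calc ‖Qmat s m n - Amat s m n‖ ^ 2
      ≤ (|s| * (1 + |s|) / 4 * (1 / (((m : ℝ) + 1) * ((n : ℝ) + 1)))) ^ 2 := by gcongr
    _ = _ := by
      field_simp

lemma hasSum_one_div_succ_sq :
    HasSum (fun n : ℕ => 1 / ((n : ℝ) + 1) ^ 2) (Real.pi ^ 2 / 6) := by
  have h := (hasSum_nat_add_iff' 1).mpr hasSum_zeta_two
  simpa using h

/-- For `s ≠ 0`, `(∑_{m≠n} |Q(s)_{mn} − A(s)_{mn}|²)^{1/2}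
  ≤ (1/2)|s|(1+|s|)^{(3+|s|)/2}`; in particular `Q(s) − A(s)` is Hilbert–Schmidt with
Hilbert–Schmidt norm at most this bound. -/
theorem stmt_10 (s : ℝ) (hs : s ≠ 0) :
    Summable (fun p : ℕ × ℕ => ‖Qmat s p.1 p.2 - Amat s p.1 p.2‖ ^ 2) ∧
    Real.sqrt (∑' p : ℕ × ℕ, ‖Qmat s p.1 p.2 - Amat s p.1 p.2‖ ^ 2) ≤
      (1 / 2) * |s| * (1 + |s|) ^ ((3 + |s|) / 2) := by
  have hz := hasSum_one_div_succ_sq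
  have hprod := hz.mul hz (hz.summable.mul_of_nonneg hz.summable
    (fun n => by positivity) (fun n => by positivity))
  have hbound := hprod.mul_left ((|s| * (1 + |s|) / 4) ^ 2)
  have hle := fun p : ℕ × ℕ => norm_Qmat_sub_Amat_sq_le s p.1 p.2
  have hsum : Summable (fun p : ℕ × ℕ => ‖Qmat s p.1 p.2 - Amat s p.1 p.2‖ ^ 2) :=
    Summable.of_nonneg_of_le (fun p => by positivity) hle hbound.summable
  refine ⟨hsum, ?_⟩
  have htsum := hasSum_le hle hsum.hasSum hbound
  have hσ := abs_nonneg s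
  have hpi : Real.pi ^ 2 / 6 ≤ 2 := by
    nlinarith [Real.pi_lt_d2, Real.pi_pos]
  have hpow : 1 + |s| ≤ (1 + |s|) ^ ((3 + |s|) / 2) := by
    have h := Real.rpow_le_rpow_of_exponent_le (show 1 ≤ 1 + |s| by linarith)
      (show 1 ≤ (3 + |s|) / 2 by linarith)
    rwa [Real.rpow_one] at h
  calc Real.sqrt (∑' p : ℕ × ℕ, ‖Qmat s p.1 p.2 - Amat s p.1 p.2‖ ^ 2)
      ≤ Real.sqrt ((|s| * (1 + |s|) / 4) ^ 2 * (Real.pi ^ 2 / 6 * (Real.pi ^ 2 / 6))) :=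
        Real.sqrt_le_sqrt htsum
    _ = |s| * (1 + |s|) / 4 * (Real.pi ^ 2 / 6) := by
        rw [← sq (Real.pi ^ 2 / 6), ← mul_pow, Real.sqrt_sq (by positivity)]
    _ ≤ |s| * (1 + |s|) / 4 * 2 := by gcongr
    _ = (1 / 2) * |s| * (1 + |s|) := by ring
    _ ≤ _ := by gcongr
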